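/- Let b_1(n) ≤ b_2(n) ≤ ⋯ ≤ b_{k−2}(n) be sequences with n^{θ_1} ≤ b_i(n) ≤ n^{θ_2} for some constants 1/2 < θ_1 ≤ θ_2 < 1 and all sufficiently large n, and suppose b_1(n)/b_{k−2}(n) → 0, i.e. b_1(n) ≪ b_{k−2}(n). Then S_B^{(k−2)}(n) = o( (1/n) · ( b_{k−2}(n)/n )^{2(α−1)} ) as n → ∞. -/

import Mathlib

open MeasureTheory Filter Set

noncomputable section

/-- `f_n(h_1,…,h_k) = ∏_{1≤i<j≤k} min(h_i h_j/(μ n), 1)`. -/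
def fDef (μ : ℝ) (n k : ℕ) (x : Fin k → ℝ) : ℝ :=
  ∏ p ∈ Finset.univ.filter (fun p : Fin k × Fin k => p.1 < p.2),
    min (x p.1 * x p.2 / (μ * n)) 1

/-- `S_B^{(h)}(n) = ∫_{[1,∞)^{k-h}} f_n(b_1,…,b_h, x_{h+1},…,x_k) dF(x_{h+1})⋯dF(x_k)`. -/
def SB (ν : Measure ℝ) (μ : ℝ) (k h : ℕ) (b : Fin h → ℝ) (n : ℕ) : ℝ :=
  ∫ x in Set.univ.pi (fun _ : Fin (k - h) => Set.Ici (1 : ℝ)),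
    fDef μ n k (fun i =>
      if hlt : i.val < h then b ⟨i.val, hlt⟩
      else x ⟨i.val - h, by have := i.isLt; omega⟩)
    ∂(Measure.pi fun _ : Fin (k - h) => ν)

open scoped ENNReal

lemma tail_bound (α : ℝ) (hα : 1 < α) (ν : Measure ℝ) [IsProbabilityMeasure ν]
    (htail : Tendsto (fun x : ℝ => x ^ α * (ν (Set.Ioi x)).toReal) atTop (nhds 1)) :
    ∃ K : ℝ, 0 < K ∧ ∀ t : ℝ, 0 < t → ν (Set.Ioi t) ≤ ENNReal.ofReal (K * t ^ (-α)) := by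
  have h2 : ∀ᶠ x : ℝ in atTop, x ^ α * (ν (Set.Ioi x)).toReal < 2 :=
    htail.eventually (gt_mem_nhds (by norm_num))
  obtain ⟨T, hT⟩ := eventually_atTop.1 h2
  set M := max T 1 with hM
  have hM1 : 1 ≤ M := le_max_right _ _
  refine ⟨2 + M ^ α, by positivity, fun t ht => ?_⟩
  rw [← ENNReal.ofReal_toReal (measure_ne_top ν (Set.Ioi t))]
  apply ENNReal.ofReal_le_ofReal
  have htp : 0 < t ^ α := Real.rpow_pos_of_pos ht α
  rw [Real.rpow_neg ht.le, ← div_eq_mul_inv, le_div_iff₀ htp]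
  have h1 : (ν (Set.Ioi t)).toReal ≤ 1 := by
    have := prob_le_one (μ := ν) (s := Set.Ioi t)
    exact ENNReal.toReal_le_of_le_ofReal zero_le_one (by simpa using this)
  have h0 : 0 ≤ (ν (Set.Ioi t)).toReal := ENNReal.toReal_nonneg
  have hMp : 0 < M ^ α := by positivity
  rcases le_or_gt M t with h | h
  · have := hT t ((le_max_left _ _).trans h)
    nlinarith
  · have : t ^ α ≤ M ^ α := Real.rpow_le_rpow ht.le h.le (by linarith)
    nlinarith

lemma phi_bound (α : ℝ) (hα : α ∈ Set.Ioo (1 : ℝ) 2) (ν : Measure ℝ) [IsProbabilityMeasure ν]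
    (hsupp : ν (Set.Iio 1) = 0)
    (htail : Tendsto (fun x : ℝ => x ^ α * (ν (Set.Ioi x)).toReal) atTop (nhds 1)) :
    ∃ C : ℝ, 0 < C ∧ ∀ v : ℝ, 0 < v →
      ∫ x, |x| * min (|x| / v) 1 ∂ν ≤ C * v ^ (1 - α) := by
  obtain ⟨hα1, hα2⟩ := hα
  obtain ⟨K, hK, hKt⟩ := tail_bound α hα1 ν htail
  have hae : ∀ᵐ x ∂ν, (1:ℝ) ≤ x := by
    rw [ae_iff]
    simpa [Set.Iio] using hsupp
  have hα2' : 0 < 2 - α := by linarith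
  have hα1' : 0 < α - 1 := by linarith
  refine ⟨2 * K * (1 / (2 - α) + 1 / (α - 1)), by positivity, fun v hv => ?_⟩
  have hgc : Continuous (fun t : ℝ => 2 * min (t / v) 1) := by fun_prop
  have key := lintegral_comp_eq_lintegral_meas_lt_mul (f := fun x : ℝ => x)
    (g := fun t : ℝ => 2 * min (t / v) 1) ν
    (by filter_upwards [hae] with x hx; exact zero_le_one.trans hx)
    measurable_id.aemeasurable (fun t _ => hgc.intervalIntegrable 0 t)
    (by
      filter_upwards [ae_restrict_mem measurableSet_Ioi] with t ht
      have ht' : (0:ℝ) < t := ht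
      positivity)
  have hcont : Continuous (fun x : ℝ => |x| * min (|x| / v) 1) := by fun_prop
  rw [integral_eq_lintegral_of_nonneg_ae (Eventually.of_forall fun x => by
    show 0 ≤ |x| * min (|x| / v) 1
    positivity) hcont.aestronglyMeasurable]
  refine ENNReal.toReal_le_of_le_ofReal (by positivity) ?_
  calc ∫⁻ x, ENNReal.ofReal (|x| * min (|x| / v) 1) ∂ν
      ≤ ∫⁻ x, ENNReal.ofReal (∫ t in (0:ℝ)..x, 2 * min (t / v) 1) ∂ν := by
        apply lintegral_mono_ae
        filter_upwards [hae] with x hx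
        apply ENNReal.ofReal_le_ofReal
        have hx0 : 0 < x := by linarith
        rw [abs_of_pos hx0]
        have e : x * min (x / v) 1 = ∫ t in (0:ℝ)..x, (2 * min (x / v) 1 / x) * t := by
          rw [intervalIntegral.integral_const_mul, integral_id]
          field_simp
          ring
        rw [e]
        apply intervalIntegral.integral_mono_on hx0.le
          ((continuous_const.mul continuous_id).intervalIntegrable 0 x)
          (hgc.intervalIntegrable 0 x)
        intro t ht
        have ht0 := ht.1
        have htx := ht.2
        have : min (x / v) 1 / x * t ≤ min (t / v) 1 := by
          apply le_min
          · calc min (x / v) 1 / x * t ≤ (x / v) / x * t := by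
                  gcongr
                  exact min_le_left _ _
              _ = t / v := by field_simp
          · calc min (x / v) 1 / x * t ≤ 1 / x * x := by
                  gcongr
                  exact min_le_right _ _
              _ = 1 := by field_simp
        show 2 * min (x / v) 1 / x * t ≤ _
        calc _ = 2 * (min (x / v) 1 / x * t) := by ring
          _ ≤ _ := by gcongr
    _ = ∫⁻ t in Ioi 0, ν {a : ℝ | t < a} * ENNReal.ofReal (2 * min (t / v) 1) := key
    _ ≤ ∫⁻ t in Ioi 0, ENNReal.ofReal (2 * K * (t ^ (-α) * min (t / v) 1)) := by
        apply setLIntegral_mono' measurableSet_Ioi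
        intro t ht
        have ht' : (0:ℝ) < t := ht
        calc _ ≤ ENNReal.ofReal (K * t ^ (-α)) * ENNReal.ofReal (2 * min (t / v) 1) := by
              gcongr
              exact hKt t ht'
          _ = _ := by
              rw [← ENNReal.ofReal_mul (by positivity)]
              congr 1
              ring
    _ = (∫⁻ t in Ioc 0 v, ENNReal.ofReal (2 * K * (t ^ (-α) * min (t / v) 1))) +
          ∫⁻ t in Ioi v, ENNReal.ofReal (2 * K * (t ^ (-α) * min (t / v) 1)) := by
        rw [← Ioc_union_Ioi_eq_Ioi hv.le, lintegral_union measurableSet_Ioi]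
        exact Set.Ioc_disjoint_Ioi le_rfl
    _ ≤ (∫⁻ t in Ioc 0 v, ENNReal.ofReal (2 * K / v * t ^ (1 - α))) +
          ∫⁻ t in Ioi v, ENNReal.ofReal (2 * K * t ^ (-α)) := by
        apply add_le_add
        · apply setLIntegral_mono' measurableSet_Ioc
          intro t ht
          have ht' : (0:ℝ) < t := ht.1
          apply ENNReal.ofReal_le_ofReal
          calc _ ≤ 2 * K * (t ^ (-α) * (t / v)) := by
                gcongr
                exact min_le_left _ _
            _ = _ := by
                rw [show (1 - α) = -α + 1 by ring, Real.rpow_add ht', Real.rpow_one]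
                ring
        · apply setLIntegral_mono' measurableSet_Ioi
          intro t ht
          have ht' : (0:ℝ) < t := hv.trans ht
          apply ENNReal.ofReal_le_ofReal
          calc _ ≤ 2 * K * (t ^ (-α) * 1) := by
                gcongr
                exact min_le_right _ _
            _ = _ := by ring
    _ = ENNReal.ofReal (2 * K / v * (v ^ (2 - α) / (2 - α))) +
          ENNReal.ofReal (2 * K * (v ^ (1 - α) / (α - 1))) := by
        congr 1
        · have hi : IntegrableOn (fun t : ℝ => t ^ (1 - α)) (Ioc 0 v) := by
            have := intervalIntegral.intervalIntegrable_rpow' (a := 0) (b := v)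
              (r := 1 - α) (by linarith)
            exact (intervalIntegrable_iff_integrableOn_Ioc_of_le hv.le).1 this
          rw [← ofReal_integral_eq_lintegral_ofReal (hi.const_mul _)]
          · rw [integral_const_mul, ← intervalIntegral.integral_of_le hv.le,
              integral_rpow (Or.inl (by linarith)), show 1 - α + 1 = 2 - α by ring,
              Real.zero_rpow hα2'.ne', sub_zero]
          · filter_upwards [ae_restrict_mem measurableSet_Ioc] with t ht
            have ht' : (0:ℝ) < t := ht.1
            show 0 ≤ 2 * K / v * t ^ (1 - α)
            positivity
        · have hi := integrableOn_Ioi_rpow_of_lt (a := -α) (by linarith) hv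
          rw [← ofReal_integral_eq_lintegral_ofReal (hi.const_mul _)]
          · rw [integral_const_mul, integral_Ioi_rpow_of_lt (by linarith) hv,
              show -α + 1 = -(α - 1) by ring, neg_div_neg_eq, show -(α - 1) = 1 - α by ring]
          · filter_upwards [ae_restrict_mem measurableSet_Ioi] with t ht
            have ht' : (0:ℝ) < t := hv.trans ht
            show 0 ≤ 2 * K * t ^ (-α)
            positivity
    _ = ENNReal.ofReal (2 * K * (1 / (2 - α) + 1 / (α - 1)) * v ^ (1 - α)) := by
        rw [← ENNReal.ofReal_add (by positivity) (by positivity)]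
        congr 1
        rw [show 2 - α = (1 - α) + 1 by ring, Real.rpow_add hv, Real.rpow_one]
        field_simp

lemma prod_fin_two (N : ℕ) (hN : N = 2) (f : Fin N → ℝ) :
    ∏ i, f i = f ⟨0, by omega⟩ * f ⟨1, by omega⟩ := by
  subst hN
  simp [Fin.prod_univ_two]

lemma fDef_nonneg (μ : ℝ) (hμ : 0 < μ) (n k : ℕ) (x : Fin k → ℝ) (hx : ∀ i, 0 ≤ x i) :
    0 ≤ fDef μ n k x := by
  apply Finset.prod_nonneg
  intro p _
  have := hx p.1
  have := hx p.2
  positivity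

lemma fDef_le (μ : ℝ) (hμ : 0 < μ) (n k : ℕ) (x : Fin k → ℝ) (hx : ∀ i, 0 ≤ x i)
    (i j l : Fin k) (hij : i < j) (hjl : j < l) :
    fDef μ n k x ≤ min (x i * x j / (μ * n)) 1 * (min (x i * x l / (μ * n)) 1 *
      min (x j * x l / (μ * n)) 1) := by
  have : fDef μ n k x ≤ ∏ p ∈ ({(i, j), (i, l), (j, l)} : Finset (Fin k × Fin k)),
      min (x p.1 * x p.2 / (μ * n)) 1 := by
    apply Finset.prod_le_prod_of_subset_of_le_one
    · intro p hp
      simp only [Finset.mem_insert, Finset.mem_singleton] at hp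
      rcases hp with rfl | rfl | rfl <;> simp [hij, hjl, hij.trans hjl]
    · intro p _
      have := hx p.1
      have := hx p.2
      positivity
    · intro p _ _
      exact min_le_right _ _
  refine this.trans (le_of_eq ?_)
  rw [Finset.prod_insert, Finset.prod_insert, Finset.prod_singleton]
  · simp [hij.ne]
  · simp [hij.ne, hjl.ne]

lemma SB_le (ν : Measure ℝ) [IsProbabilityMeasure ν] (hint : Integrable (fun x : ℝ => x) ν)
    (μ : ℝ) (hμ : 0 < μ) (k : ℕ) (hk : 3 ≤ k) (n : ℕ) (hn : 0 < n)
    (b : Fin (k - 2) → ℝ) (hb : ∀ i, 1 ≤ b i) :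
    0 ≤ SB ν μ k (k - 2) b n ∧
    SB ν μ k (k - 2) b n ≤ 1 / (μ * n) *
      (∫ x, |x| * min (|x| / (μ * n / b ⟨0, by omega⟩)) 1 ∂ν) ^ 2 := by
  set v := μ * n / b ⟨0, by omega⟩ with hv
  have hn' : (0:ℝ) < n := by exact_mod_cast hn
  have hb0 : 0 < b ⟨0, by omega⟩ := zero_lt_one.trans_le (hb _)
  have hvpos : 0 < v := by positivity
  set φ : ℝ → ℝ := fun x => |x| * min (|x| / v) 1 with hφ
  have hφ0 : ∀ x, 0 ≤ φ x := fun x => by simp only [hφ]; positivity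
  have hφc : Continuous φ := by simp only [hφ]; fun_prop
  have hφi : Integrable φ ν := by
    refine hint.mono hφc.aestronglyMeasurable (Eventually.of_forall fun x => ?_)
    rw [Real.norm_of_nonneg (hφ0 x), Real.norm_eq_abs]
    exact mul_le_of_le_one_right (abs_nonneg x) (min_le_right _ _)
  have hN : k - (k - 2) = 2 := by omega
  have hms : MeasurableSet (Set.univ.pi (fun _ : Fin (k - (k - 2)) => Set.Ici (1 : ℝ))) :=
    MeasurableSet.univ_pi fun _ => measurableSet_Ici
  have hpi : Integrable (fun x : Fin (k - (k - 2)) → ℝ => 1 / (μ * n) * ∏ i, φ (x i))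
      (Measure.pi fun _ : Fin (k - (k - 2)) => ν) :=
    (Integrable.fintype_prod (f := fun _ => φ) (fun _ => hφi)).const_mul _
  have hnn : ∀ x ∈ Set.univ.pi (fun _ : Fin (k - (k - 2)) => Set.Ici (1 : ℝ)), ∀ i : Fin k,
      0 ≤ (fun i : Fin k =>
      if hlt : i.val < k - 2 then b ⟨i.val, hlt⟩
      else x ⟨i.val - (k - 2), by have := i.isLt; omega⟩) i := by
    intro x hx i
    dsimp only
    split_ifs with h
    · exact zero_le_one.trans (hb _)
    · exact zero_le_one.trans (hx _ (Set.mem_univ _))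
  have h0 : 0 ≤ᵐ[(Measure.pi fun _ : Fin (k - (k - 2)) => ν).restrict
      (Set.univ.pi (fun _ : Fin (k - (k - 2)) => Set.Ici (1 : ℝ)))]
      (fun x => fDef μ n k (fun i : Fin k =>
      if hlt : i.val < k - 2 then b ⟨i.val, hlt⟩
      else x ⟨i.val - (k - 2), by have := i.isLt; omega⟩)) := by
    filter_upwards [ae_restrict_mem hms] with x hx
    exact fDef_nonneg μ hμ n k _ (hnn x hx)
  refine ⟨integral_nonneg_of_ae h0, ?_⟩
  calc SB ν μ k (k - 2) b n
      ≤ ∫ x in Set.univ.pi (fun _ : Fin (k - (k - 2)) => Set.Ici (1 : ℝ)),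
        1 / (μ * n) * ∏ i, φ (x i) ∂(Measure.pi fun _ : Fin (k - (k - 2)) => ν) := by
        refine integral_mono_of_nonneg h0 hpi.integrableOn ?_
        filter_upwards [ae_restrict_mem hms] with x hx
        refine (fDef_le μ hμ n k _ (hnn x hx) ⟨0, by omega⟩ ⟨k - 2, by omega⟩ ⟨k - 1, by omega⟩
          (by simp [Fin.lt_def]; omega) (by simp [Fin.lt_def]; omega)).trans ?_
        rw [prod_fin_two _ hN]
        have e1 : k - 1 - (k - 2) = 1 := by omega
        have e2 : ¬ (k - 1 < k - 2) := by omega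
        have e3 : 0 < k - 2 := by omega
        simp only [e1, e2, e3, lt_irrefl, Nat.sub_self, dite_true, dite_false]
        have hx0 : 1 ≤ x ⟨0, by omega⟩ := hx _ (Set.mem_univ _)
        have hx1 : 1 ≤ x ⟨1, by omega⟩ := hx _ (Set.mem_univ _)
        generalize x ⟨0, by omega⟩ = y at *
        generalize x ⟨1, by omega⟩ = z at *
        simp only [hφ]
        rw [abs_of_nonneg (by linarith : 0 ≤ y), abs_of_nonneg (by linarith : 0 ≤ z)]
        have f1 : ∀ w, b ⟨0, by omega⟩ * w / (μ * n) = w / v := by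
          intro w
          rw [hv]
          field_simp
        rw [f1, f1]
        calc _ ≤ min (y / v) 1 * (min (z / v) 1 * (y * z / (μ * n))) := by
              gcongr
              exact min_le_left _ _
          _ = _ := by ring
    _ ≤ ∫ x, 1 / (μ * n) * ∏ i, φ (x i) ∂(Measure.pi fun _ : Fin (k - (k - 2)) => ν) := by
        refine setIntegral_le_integral hpi (Eventually.of_forall fun x => ?_)
        have := Finset.prod_nonneg (s := Finset.univ) fun i _ => hφ0 (x i)
        show 0 ≤ 1 / (μ * n) * ∏ i, φ (x i)
        positivity
    _ = _ := by
        rw [integral_const_mul, integral_fintype_prod_eq_pow, Fintype.card_fin, hN]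

/-- for `k-2` ordered hubs with `n^{θ₁} ≤ b_i(n) ≤ n^{θ₂}`,
`1/2 < θ₁ ≤ θ₂ < 1`, and `b_1(n) ≪ b_{k-2}(n)`,
`S_B^{(k-2)}(n) = o((1/n) (b_{k-2}(n)/n)^{2(α-1)})`. -/
theorem stmt8
    (α : ℝ) (hα : α ∈ Set.Ioo (1 : ℝ) 2)
    (ν : Measure ℝ) [IsProbabilityMeasure ν]
    (hsupp : ν (Set.Iio 1) = 0)
    (htail : Tendsto (fun x : ℝ => x ^ α * (ν (Set.Ioi x)).toReal) atTop (nhds 1))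
    (g : ℝ → ℝ)
    (hdens : ν = MeasureTheory.volume.withDensity (fun x => ENNReal.ofReal (g x)))
    (hgtail : Tendsto (fun x : ℝ => g x * x ^ (α + 1)) atTop (nhds α))
    (hint : Integrable (fun x : ℝ => x) ν)
    (μ : ℝ) (hμ : μ = ∫ x, x ∂ν)
    (k : ℕ) (hk : 3 ≤ k)
    (b : Fin (k - 2) → ℕ → ℝ) (hbval : ∀ i m, 1 ≤ b i m)
    (hmono : ∀ (m : ℕ) (i j : Fin (k - 2)), i ≤ j → b i m ≤ b j m)
    (θ₁ θ₂ : ℝ) (hθ₁ : 1 / 2 < θ₁) (hθ₁₂ : θ₁ ≤ θ₂) (hθ₂ : θ₂ < 1)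
    (hb : ∀ᶠ n : ℕ in atTop, ∀ i, (n : ℝ) ^ θ₁ ≤ b i n ∧ b i n ≤ (n : ℝ) ^ θ₂)
    (hratio : Tendsto
      (fun n : ℕ => b ⟨0, by omega⟩ n / b ⟨k - 3, by omega⟩ n) atTop (nhds 0)) :
    Tendsto (fun n : ℕ =>
        SB ν μ k (k - 2) (fun i => b i n) n /
          (1 / (n : ℝ) * (b ⟨k - 3, by omega⟩ n / (n : ℝ)) ^ (2 * (α - 1))))
      atTop (nhds 0) := by
  have hα1' : 0 < α - 1 := by linarith [hα.1]
  obtain ⟨C, hC, hCv⟩ := phi_bound α hα ν hsupp htail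
  have hae : ∀ᵐ x ∂ν, (1:ℝ) ≤ x := by
    rw [ae_iff]
    simpa [Set.Iio] using hsupp
  have hμ1 : 1 ≤ μ := by
    rw [hμ]
    have := integral_mono_ae (integrable_const (1:ℝ)) hint hae
    simpa using this
  have hμ0 : 0 < μ := by linarith
  set D := 1 / μ * (C * (μ ^ (1 - α))) ^ 2 with hD
  have hlim : Tendsto (fun n : ℕ =>
      D * ((b ⟨0, by omega⟩ n / b ⟨k - 3, by omega⟩ n) ^ (α - 1)) ^ 2) atTop (nhds 0) := by
    have h1 := hratio.rpow_const (p := α - 1) (Or.inr hα1'.le)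
    rw [Real.zero_rpow hα1'.ne'] at h1
    simpa using (h1.pow 2).const_mul D
  have hpos : ∀ i m, 0 < b i m := fun i m => zero_lt_one.trans_le (hbval i m)
  refine tendsto_of_tendsto_of_tendsto_of_le_of_le' tendsto_const_nhds hlim ?_ ?_
  · filter_upwards [eventually_gt_atTop 0] with n hn
    have h := (SB_le ν hint μ hμ0 k hk n hn (fun i => b i n) (fun i => hbval i n)).1
    have := hpos ⟨k - 3, by omega⟩ n
    positivity
  · filter_upwards [eventually_gt_atTop 0] with n hn
    have hn' : (0:ℝ) < n := by exact_mod_cast hn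
    have h := (SB_le ν hint μ hμ0 k hk n hn (fun i => b i n) (fun i => hbval i n)).2
    have hB := hpos ⟨k - 3, by omega⟩ n
    have hb0 := hpos ⟨0, by omega⟩ n
    generalize b ⟨k - 3, by omega⟩ n = B at *
    generalize b ⟨0, by omega⟩ n = a at *
    have hI0 : 0 ≤ ∫ x, |x| * min (|x| / (μ * n / a)) 1 ∂ν :=
      integral_nonneg fun x => by
        show 0 ≤ |x| * min (|x| / (μ * n / a)) 1
        positivity
    have hI := hCv (μ * n / a) (by positivity)
    have hBn : 0 < B / n := by positivity
    have e1 : (μ * n / a) ^ (1 - α) = μ ^ (1 - α) * ((a / B) ^ (α - 1) * (B / n) ^ (α - 1)) := by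
      rw [← Real.mul_rpow (by positivity) (by positivity),
        show a / B * (B / n) = (n / a)⁻¹ by field_simp, Real.inv_rpow (by positivity),
        ← Real.rpow_neg (by positivity), show -(α - 1) = 1 - α by ring,
        ← Real.mul_rpow (by positivity) (by positivity), mul_div_assoc]
    have e2 : (B / n) ^ (2 * (α - 1)) = ((B / n) ^ (α - 1)) ^ 2 := by
      rw [mul_comm, Real.rpow_mul hBn.le]
      norm_cast
    rw [div_le_iff₀ (by positivity)]
    calc _ ≤ _ := h
      _ ≤ 1 / (μ * n) * (C * (μ * n / a) ^ (1 - α)) ^ 2 := by gcongr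
      _ = _ := by
        rw [e1, e2, hD]
        field_simp
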